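/- Let n ≥ 1 and let u₀, u₁ : ℝⁿ → ℝ be smooth functions such that ∇u₀, ∇u₁, and u₁ − u₀ are ℤⁿ-periodic, let Θ ∈ [(n−1)π/2, (n+1)π/2) with ϑ(∇²u_i(x)) > Θ − π/2 for all x and i = 0, 1. Then there exists a constant C, depending only on n, Θ, u₀ and u₁ (and not on τ), such that for every τ ∈ (0,1] and every smooth function v^τ : [0,√τ] × ℝⁿ → ℝ, ℤⁿ-periodic in x, vanishing on {0, √τ} × ℝⁿ, and satisfying ∑_{j=1}^{n+1} arctan λ_j(D²(ũ^τ + v^τ)) = Θ everywhere, the rescaled function v̂^τ(t,x) := v^τ(√τ·t, x) on [0,1] × ℝⁿ satisfies sup(|v̂^τ| + |∂_t v̂^τ| + |∇_x v̂^τ|) ≤ C. -/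

import Mathlib

/-- The Lagrangian phase `ϑ(M) = ∑ arctan λ_j(M)` of a real symmetric matrix, where the
`λ_j(M)` are its eigenvalues listed with multiplicity; `0` if `M` is not symmetric. -/
noncomputable def lagPhase {ι : Type*} [Fintype ι] [DecidableEq ι]
    (M : Matrix ι ι ℝ) : ℝ :=
  if h : M.IsHermitian then ∑ j, Real.arctan (h.eigenvalues j) else 0

/-- The Hessian matrix of a function `f : ℝ^m → ℝ` at a point `x`. -/
noncomputable def hess {m : ℕ} (f : (Fin m → ℝ) → ℝ) (x : Fin m → ℝ) :
    Matrix (Fin m) (Fin m) ℝ :=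
  Matrix.of fun i j => fderiv ℝ (fun y => fderiv ℝ f y (Pi.single j 1)) x (Pi.single i 1)

section Eigenvalues

open Matrix

variable {ι : Type*} [Fintype ι] [DecidableEq ι] {A B : Matrix ι ι ℝ}

theorem Matrix.IsHermitian.sum_dotProduct_eigenvectorBasis_mul (hA : A.IsHermitian)
    (x y : ι → ℝ) :
    ∑ j, (hA.eigenvectorBasis j ⬝ᵥ x) * (hA.eigenvectorBasis j ⬝ᵥ y) = x ⬝ᵥ y := by
  have h := hA.eigenvectorBasis.sum_inner_mul_inner (WithLp.toLp 2 x) (WithLp.toLp 2 y)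
  simp only [EuclideanSpace.inner_eq_star_dotProduct, star_trivial] at h
  rw [dotProduct_comm x y, ← h]
  refine Finset.sum_congr rfl fun j _ => ?_
  rw [dotProduct_comm y]

theorem Matrix.IsHermitian.eigenvectorBasis_dotProduct_mulVec (hA : A.IsHermitian)
    (x : ι → ℝ) (j : ι) :
    hA.eigenvectorBasis j ⬝ᵥ A *ᵥ x = hA.eigenvalues j * (hA.eigenvectorBasis j ⬝ᵥ x) := by
  have hT : Aᵀ = A := by simpa using hA.eq
  rw [dotProduct_mulVec, ← mulVec_transpose, hT, hA.mulVec_eigenvectorBasis, smul_dotProduct,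
    smul_eq_mul]

theorem Matrix.IsHermitian.dotProduct_mulVec_eq_sum (hA : A.IsHermitian) (x : ι → ℝ) :
    x ⬝ᵥ A *ᵥ x = ∑ j, hA.eigenvalues j * (hA.eigenvectorBasis j ⬝ᵥ x) ^ 2 := by
  rw [← hA.sum_dotProduct_eigenvectorBasis_mul]
  refine Finset.sum_congr rfl fun j _ => ?_
  rw [hA.eigenvectorBasis_dotProduct_mulVec]
  ring

/-- Weyl's monotonicity principle for the ordered eigenvalues of symmetric matrices. -/
theorem Matrix.IsHermitian.eigenvalues_le_add (hA : A.IsHermitian) (hB : B.IsHermitian) {η : ℝ}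
    (h : ∀ x : ι → ℝ, x ⬝ᵥ A *ᵥ x ≤ x ⬝ᵥ B *ᵥ x + η * (x ⬝ᵥ x)) (i : ι) :
    hA.eigenvalues i ≤ hB.eigenvalues i + η := by
  set e : ι ≃ Fin (Fintype.card ι) := (Fintype.equivOfCardEq (Fintype.card_fin _)).symm with he
  let L : (ι → ℝ) →ₗ[ℝ] ({j // j ≠ i} → ℝ) := LinearMap.pi fun j =>
    if e i < e j then dotProductBilin ℝ ℝ (hA.eigenvectorBasis j : ι → ℝ)
    else dotProductBilin ℝ ℝ (hB.eigenvectorBasis j : ι → ℝ)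
  have hL : LinearMap.ker L ≠ ⊥ := by
    apply LinearMap.ker_ne_bot_of_finrank_lt
    simp only [Module.finrank_fintype_fun_eq_card]
    exact Fintype.card_subtype_lt (x := i) (by simp)
  obtain ⟨x, hx, hx0⟩ := Submodule.exists_mem_ne_zero_of_ne_bot hL
  have hLx : ∀ j (hj : j ≠ i), L x ⟨j, hj⟩ = 0 := fun j hj => by
    rw [LinearMap.mem_ker.mp hx]; rfl
  have hxA : ∀ j, e i < e j → (hA.eigenvectorBasis j : ι → ℝ) ⬝ᵥ x = 0 := fun j hj => by
    have := hLx j (by rintro rfl; exact lt_irrefl _ hj)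
    simpa [L, hj] using this
  have hxB : ∀ j, e j < e i → (hB.eigenvectorBasis j : ι → ℝ) ⬝ᵥ x = 0 := fun j hj => by
    have := hLx j (by rintro rfl; exact lt_irrefl _ hj)
    simpa [L, hj.not_gt] using this
  have hpos : 0 < x ⬝ᵥ x := by
    refine lt_of_le_of_ne (Finset.sum_nonneg fun j _ => mul_self_nonneg _) ?_
    intro h0
    exact hx0 (dotProduct_self_eq_zero.mp h0.symm)
  have h1 : hA.eigenvalues i * (x ⬝ᵥ x) ≤ x ⬝ᵥ A *ᵥ x := by
    rw [hA.dotProduct_mulVec_eq_sum, ← hA.sum_dotProduct_eigenvectorBasis_mul, Finset.mul_sum]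
    refine Finset.sum_le_sum fun j _ => ?_
    rcases lt_or_ge (e i) (e j) with hj | hj
    · simp [hxA j hj]
    · rw [sq]
      exact mul_le_mul_of_nonneg_right (hA.eigenvalues₀_antitone hj) (mul_self_nonneg _)
  have h2 : x ⬝ᵥ B *ᵥ x ≤ hB.eigenvalues i * (x ⬝ᵥ x) := by
    rw [hB.dotProduct_mulVec_eq_sum, ← hB.sum_dotProduct_eigenvectorBasis_mul, Finset.mul_sum]
    refine Finset.sum_le_sum fun j _ => ?_
    rcases lt_or_ge (e j) (e i) with hj | hj
    · simp [hxB j hj]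
    · rw [sq]
      exact mul_le_mul_of_nonneg_right (hB.eigenvalues₀_antitone hj) (mul_self_nonneg _)
  have h3 := h x
  refine le_of_mul_le_mul_right ?_ hpos
  linarith

theorem Matrix.IsHermitian.trace_eq_sum_real_eigenvalues (hA : A.IsHermitian) :
    A.trace = ∑ j, hA.eigenvalues j := by
  simpa using hA.trace_eq_sum_eigenvalues

end Eigenvalues

section LagPhase

open Matrix

variable {ι : Type*} [Fintype ι] [DecidableEq ι] {A B : Matrix ι ι ℝ}

theorem lagPhase_eq (hA : A.IsHermitian) : lagPhase A = ∑ j, Real.arctan (hA.eigenvalues j) :=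
  dif_pos hA

theorem lagPhase_mono (hA : A.IsHermitian) (hB : B.IsHermitian)
    (h : ∀ x : ι → ℝ, x ⬝ᵥ A *ᵥ x ≤ x ⬝ᵥ B *ᵥ x) : lagPhase A ≤ lagPhase B := by
  rw [lagPhase_eq hA, lagPhase_eq hB]
  refine Finset.sum_le_sum fun j _ => Real.arctan_strictMono.monotone ?_
  simpa using hA.eigenvalues_le_add hB (η := 0) (by simpa using h) j

theorem lagPhase_strictMono (hA : A.IsHermitian) (hB : B.IsHermitian)
    (h : ∀ x : ι → ℝ, x ⬝ᵥ A *ᵥ x ≤ x ⬝ᵥ B *ᵥ x) (ht : A.trace < B.trace) :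
    lagPhase A < lagPhase B := by
  have hle : ∀ j, hA.eigenvalues j ≤ hB.eigenvalues j := fun j => by
    simpa using hA.eigenvalues_le_add hB (η := 0) (by simpa using h) j
  rw [hA.trace_eq_sum_real_eigenvalues, hB.trace_eq_sum_real_eigenvalues] at ht
  obtain ⟨j, -, hj⟩ := Finset.exists_lt_of_sum_lt ht
  rw [lagPhase_eq hA, lagPhase_eq hB]
  exact Finset.sum_lt_sum (fun j _ => Real.arctan_strictMono.monotone (hle j))
    ⟨j, Finset.mem_univ j, Real.arctan_strictMono hj⟩

/-- Lower semicontinuity of the phase, expressed through quadratic forms. -/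
theorem exists_lagPhase_gt_of_dotProduct_le (hA : A.IsHermitian) {c : ℝ} (hc : c < lagPhase A) :
    ∃ η > 0, ∀ B : Matrix ι ι ℝ, B.IsHermitian →
      (∀ x : ι → ℝ, x ⬝ᵥ A *ᵥ x ≤ x ⬝ᵥ B *ᵥ x + η * (x ⬝ᵥ x)) → c < lagPhase B := by
  have hcont : Continuous fun η : ℝ => ∑ j, Real.arctan (hA.eigenvalues j - η) := by fun_prop
  have h0 : ∀ᶠ η in nhds (0 : ℝ), c < ∑ j, Real.arctan (hA.eigenvalues j - η) :=
    hcont.continuousAt.eventually_const_lt (by simpa [← lagPhase_eq hA] using hc)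
  obtain ⟨η, hη, hη0⟩ :=
    ((h0.filter_mono nhdsWithin_le_nhds).and (self_mem_nhdsWithin (s := Set.Ioi 0))).exists
  refine ⟨η, hη0, fun B hB h => hη.trans_le ?_⟩
  rw [lagPhase_eq hB]
  refine Finset.sum_le_sum fun j _ => Real.arctan_strictMono.monotone ?_
  linarith [hA.eigenvalues_le_add hB h j]

/-- A matrix whose phase is at least critical has nonnegative trace. -/
theorem trace_nonneg_of_le_lagPhase (hA : A.IsHermitian) (hcard : 2 ≤ Fintype.card ι)
    (h : ((Fintype.card ι : ℝ) - 2) * Real.pi / 2 ≤ lagPhase A) : 0 ≤ A.trace := by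
  rw [hA.trace_eq_sum_real_eigenvalues]
  by_cases hneg : ∀ j, 0 ≤ hA.eigenvalues j
  · exact Finset.sum_nonneg fun j _ => hneg j
  push Not at hneg
  obtain ⟨i, hi⟩ := hneg
  rw [lagPhase_eq hA] at h
  have key : ∀ j, j ≠ i → -hA.eigenvalues i ≤ hA.eigenvalues j := by
    intro j hj
    have hs : ∑ k ∈ (Finset.univ.erase i).erase j, Real.arctan (hA.eigenvalues k)
        ≤ ((Fintype.card ι : ℝ) - 2) * Real.pi / 2 := by
      have hc : ((((Finset.univ : Finset ι).erase i).erase j).card : ℝ)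
          = (Fintype.card ι : ℝ) - 2 := by
        rw [Finset.card_erase_of_mem (by simp [hj]), Finset.card_erase_of_mem (by simp),
          Finset.card_univ, Nat.sub_sub, Nat.cast_sub (by omega)]
        norm_num
      calc _ ≤ ∑ k ∈ (Finset.univ.erase i).erase j, Real.pi / 2 :=
            Finset.sum_le_sum fun k _ => (Real.arctan_lt_pi_div_two _).le
        _ = _ := by rw [Finset.sum_const, nsmul_eq_mul, hc]; ring
    rw [← Finset.add_sum_erase _ _ (Finset.mem_univ i),
      ← Finset.add_sum_erase _ _ (show j ∈ Finset.univ.erase i by simp [hj])] at h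
    rw [← Real.arctan_strictMono.le_iff_le, Real.arctan_neg]
    linarith
  obtain ⟨j, hj⟩ := Fintype.exists_ne_of_one_lt_card (by omega) i
  rw [← Finset.add_sum_erase _ _ (Finset.mem_univ i),
    ← Finset.add_sum_erase _ _ (show j ∈ Finset.univ.erase i by simp [hj])]
  have hrest : 0 ≤ ∑ k ∈ (Finset.univ.erase i).erase j, hA.eigenvalues k := by
    refine Finset.sum_nonneg fun k hk => ?_
    have := key k (by simp at hk; tauto)
    linarith
  linarith [key j hj]

theorem lagPhase_eq_sum_roots (hA : A.IsHermitian) :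
    lagPhase A = (A.charpoly.roots.map Real.arctan).sum := by
  rw [lagPhase_eq hA, hA.roots_charpoly_eq_eigenvalues, Multiset.map_map]
  rfl

/-- The block diagonal matrix with blocks `(a)` and `M`. -/
def consDiag {n : ℕ} (a : ℝ) (M : Matrix (Fin n) (Fin n) ℝ) :
    Matrix (Fin (n + 1)) (Fin (n + 1)) ℝ :=
  Matrix.of (Fin.cons (Fin.cons a 0) fun i => Fin.cons 0 (M i))

variable {n : ℕ} {a : ℝ} {M : Matrix (Fin n) (Fin n) ℝ}

theorem consDiag_isHermitian (hM : M.IsHermitian) : (consDiag a M).IsHermitian := by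
  ext i j
  refine Fin.cases ?_ (fun i => ?_) i <;> refine Fin.cases ?_ (fun j => ?_) j
  · simp [consDiag]
  · simp [consDiag]
  · simp [consDiag]
  · simpa [consDiag] using hM.apply i j

theorem dotProduct_consDiag_mulVec (x : Fin (n + 1) → ℝ) :
    x ⬝ᵥ consDiag a M *ᵥ x = a * x 0 ^ 2 + Fin.tail x ⬝ᵥ M *ᵥ Fin.tail x := by
  simp only [dotProduct, mulVec, Fin.sum_univ_succ, consDiag, of_apply, Fin.cons_zero,
    Fin.cons_succ, Pi.zero_apply, zero_mul, Finset.sum_const_zero, add_zero, zero_add, Fin.tail]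
  ring

theorem charpoly_consDiag :
    (consDiag a M).charpoly = (Polynomial.X - Polynomial.C a) * M.charpoly := by
  rw [Matrix.charpoly, det_succ_row_zero, Fin.sum_univ_succ]
  have h0 : ∀ i : Fin n, (consDiag a M).charmatrix 0 i.succ = 0 := fun i => by
    rw [charmatrix_apply_ne _ _ _ (Fin.succ_ne_zero i).symm]
    simp [consDiag]
  have h1 : (consDiag a M).charmatrix.submatrix Fin.succ (Fin.succAbove 0) = M.charmatrix := by
    ext1 i j
    simp [consDiag, charmatrix_apply, diagonal_apply]
  simp only [h0, h1]
  simp [consDiag, charmatrix_apply_eq, Matrix.charpoly]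

theorem lagPhase_consDiag (hM : M.IsHermitian) :
    lagPhase (consDiag a M) = Real.arctan a + lagPhase M := by
  rw [lagPhase_eq_sum_roots (consDiag_isHermitian hM), lagPhase_eq_sum_roots hM, charpoly_consDiag,
    Polynomial.roots_mul
      (mul_ne_zero (Polynomial.X_sub_C_ne_zero a) M.charpoly_monic.ne_zero)]
  simp

end LagPhase

section SecondDerivative

variable {m : ℕ} {f g : (Fin m → ℝ) → ℝ}

/-- The second derivative of `f` at `x` along the line of direction `ξ`. -/
noncomputable def lineSecondDeriv (f : (Fin m → ℝ) → ℝ) (x ξ : Fin m → ℝ) : ℝ :=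
  deriv (deriv fun r : ℝ => f (x + r • ξ)) 0

theorem contDiff_comp_line {k : WithTop ℕ∞} (hf : ContDiff ℝ k f) (x ξ : Fin m → ℝ) :
    ContDiff ℝ k fun r : ℝ => f (x + r • ξ) :=
  hf.comp (contDiff_const.add (contDiff_id.smul contDiff_const))

theorem hasDerivAt_comp_line (hf : Differentiable ℝ f) (x ξ : Fin m → ℝ) (r : ℝ) :
    HasDerivAt (fun r : ℝ => f (x + r • ξ)) (fderiv ℝ f (x + r • ξ) ξ) r := by
  have h : HasDerivAt (fun r : ℝ => x + r • ξ) ξ r := by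
    simpa using ((hasDerivAt_id r).smul_const ξ).const_add x
  exact (hf (x + r • ξ)).hasFDerivAt.comp_hasDerivAt r h

theorem differentiable_fderiv_apply (hf : ContDiff ℝ 2 f) (ξ : Fin m → ℝ) :
    Differentiable ℝ fun y => fderiv ℝ f y ξ :=
  ((hf.fderiv_right (m := 1) (by norm_num)).differentiable (by norm_num)).clm_apply
    (differentiable_const ξ)

theorem hess_apply (hf : ContDiff ℝ 2 f) (x : Fin m → ℝ) (i j : Fin m) :
    hess f x i j = fderiv ℝ (fderiv ℝ f) x (Pi.single i 1) (Pi.single j 1) := by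
  have hd : DifferentiableAt ℝ (fderiv ℝ f) x :=
    (hf.fderiv_right (m := 1) (by norm_num)).differentiable (by norm_num) x
  simp only [hess, Matrix.of_apply]
  rw [fderiv_clm_apply hd (differentiableAt_const _)]
  simp

theorem hess_isHermitian (hf : ContDiff ℝ 2 f) (x : Fin m → ℝ) : (hess f x).IsHermitian := by
  ext i j
  have h := (hf.contDiffAt (x := x)).isSymmSndFDerivAt (by simp)
  rw [Matrix.conjTranspose_apply, star_trivial, hess_apply hf, hess_apply hf]
  exact h _ _

theorem lineSecondDeriv_eq_fderiv (hf : ContDiff ℝ 2 f) (x ξ : Fin m → ℝ) :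
    lineSecondDeriv f x ξ = fderiv ℝ (fderiv ℝ f) x ξ ξ := by
  have hd : DifferentiableAt ℝ (fderiv ℝ f) x :=
    (hf.fderiv_right (m := 1) (by norm_num)).differentiable (by norm_num) x
  have h1 : deriv (fun r : ℝ => f (x + r • ξ)) = fun r => fderiv ℝ f (x + r • ξ) ξ :=
    funext fun r => (hasDerivAt_comp_line (hf.differentiable (by norm_num)) x ξ r).deriv
  rw [lineSecondDeriv, h1, (hasDerivAt_comp_line (differentiable_fderiv_apply hf ξ) x ξ 0).deriv]
  simp only [zero_smul, add_zero]
  rw [fderiv_clm_apply hd (differentiableAt_const _)]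
  simp

open Matrix in
theorem lineSecondDeriv_eq_dotProduct (hf : ContDiff ℝ 2 f) (x ξ : Fin m → ℝ) :
    lineSecondDeriv f x ξ = ξ ⬝ᵥ hess f x *ᵥ ξ := by
  rw [lineSecondDeriv_eq_fderiv hf]
  set T := fderiv ℝ (fderiv ℝ f) x with hT
  have hξ : ξ = ∑ i, ξ i • (Pi.single i 1 : Fin m → ℝ) := pi_eq_sum_univ' ξ
  conv_lhs => rw [hξ]
  simp only [map_sum, map_smul, _root_.sum_apply, _root_.smul_apply,
    smul_eq_mul, dotProduct, mulVec, hess_apply hf, Finset.mul_sum, ← hT]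
  rw [Finset.sum_comm]
  refine Finset.sum_congr rfl fun i _ => Finset.sum_congr rfl fun j _ => ?_
  ring

theorem trace_hess (hf : ContDiff ℝ 2 f) (x : Fin m → ℝ) :
    (hess f x).trace = ∑ i, lineSecondDeriv f x (Pi.single i 1) := by
  refine Finset.sum_congr rfl fun i _ => ?_
  rw [lineSecondDeriv_eq_fderiv hf, Matrix.diag_apply, hess_apply hf]

theorem deriv_deriv_add {φ ψ : ℝ → ℝ} (hφ : ContDiff ℝ 2 φ) (hψ : ContDiff ℝ 2 ψ) (r : ℝ) :
    deriv (deriv fun s => φ s + ψ s) r = deriv (deriv φ) r + deriv (deriv ψ) r := by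
  have h2 : ∀ {χ : ℝ → ℝ}, ContDiff ℝ 2 χ → Differentiable ℝ χ ∧ Differentiable ℝ (deriv χ) :=
    fun h => ⟨h.differentiable (by norm_num),
      ((contDiff_succ_iff_deriv (n := 1)).mp h).2.2.differentiable (by norm_num)⟩
  have h1 : (deriv fun s => φ s + ψ s) = fun s => deriv φ s + deriv ψ s :=
    funext fun s => deriv_fun_add ((h2 hφ).1 s) ((h2 hψ).1 s)
  rw [h1, deriv_fun_add ((h2 hφ).2 r) ((h2 hψ).2 r)]

theorem lineSecondDeriv_add (hf : ContDiff ℝ 2 f) (hg : ContDiff ℝ 2 g) (x ξ : Fin m → ℝ) :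
    lineSecondDeriv (fun y => f y + g y) x ξ = lineSecondDeriv f x ξ + lineSecondDeriv g x ξ :=
  deriv_deriv_add (contDiff_comp_line hf x ξ) (contDiff_comp_line hg x ξ) 0

theorem lineSecondDeriv_const_mul (c : ℝ) (f : (Fin m → ℝ) → ℝ) (x ξ : Fin m → ℝ) :
    lineSecondDeriv (fun y => c * f y) x ξ = c * lineSecondDeriv f x ξ := by
  simp only [lineSecondDeriv, deriv_const_mul_field']

theorem lineSecondDeriv_sub (hf : ContDiff ℝ 2 f) (hg : ContDiff ℝ 2 g) (x ξ : Fin m → ℝ) :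
    lineSecondDeriv (fun y => f y - g y) x ξ = lineSecondDeriv f x ξ - lineSecondDeriv g x ξ := by
  have h := lineSecondDeriv_add hf (contDiff_const.mul hg : ContDiff ℝ 2 fun y => (-1) * g y) x ξ
  rw [lineSecondDeriv_const_mul] at h
  rw [show (fun y => f y - g y) = fun y => f y + (-1) * g y by ext y; ring, h]
  ring

theorem deriv_deriv_quadratic (b c e r : ℝ) :
    deriv (deriv fun s : ℝ => b * s ^ 2 + c * s + e) r = 2 * b := by
  have h1 : (deriv fun s : ℝ => b * s ^ 2 + c * s + e) = fun s => 2 * b * s + c := by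
    ext s
    have := (((hasDerivAt_pow 2 s).const_mul b).add ((hasDerivAt_id s).const_mul c)).add_const e
    refine (this.congr_deriv ?_).deriv
    simp
    ring
  rw [h1]
  simp

theorem hess_comp_add_right (f : (Fin m → ℝ) → ℝ) (y x : Fin m → ℝ) :
    hess (fun p => f (p + y)) x = hess f (x + y) := by
  ext i j
  simp only [hess, Matrix.of_apply, fderiv_comp_add_right]
  rw [fderiv_comp_add_right (f := fun z => fderiv ℝ f z (Pi.single j 1))]

theorem continuous_hess_apply (hf : ContDiff ℝ 2 f) (i j : Fin m) :
    Continuous fun x => hess f x i j := by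
  simp only [hess_apply hf]
  have h : Continuous (fderiv ℝ (fderiv ℝ f)) :=
    ((hf.fderiv_right (m := 1) (by norm_num)).fderiv_right (m := 0) (by norm_num)).continuous
  exact (h.clm_apply continuous_const).clm_apply continuous_const

end SecondDerivative

section Slab

variable {n : ℕ}

/-- A quadratic function of the first coordinate. -/
def heightQuadratic (b c e : ℝ) (p : Fin (n + 1) → ℝ) : ℝ := b * p 0 ^ 2 + c * p 0 + e

theorem contDiff_heightQuadratic {k : WithTop ℕ∞} (b c e : ℝ) :
    ContDiff ℝ k (heightQuadratic (n := n) b c e) := by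
  unfold heightQuadratic
  fun_prop

theorem lineSecondDeriv_heightQuadratic (b c e : ℝ) (p ξ : Fin (n + 1) → ℝ) :
    lineSecondDeriv (heightQuadratic b c e) p ξ = 2 * b * ξ 0 ^ 2 := by
  have h : (fun r : ℝ => heightQuadratic b c e (p + r • ξ)) = fun r =>
      (b * ξ 0 ^ 2) * r ^ 2 + (2 * b * p 0 * ξ 0 + c * ξ 0) * r
        + (b * p 0 ^ 2 + c * p 0 + e) := by
    ext r
    simp only [heightQuadratic, Pi.add_apply, Pi.smul_apply, smul_eq_mul]
    ring
  rw [lineSecondDeriv, h, deriv_deriv_quadratic]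
  ring

theorem contDiff_comp_tail {k : WithTop ℕ∞} {g : (Fin n → ℝ) → ℝ} (hg : ContDiff ℝ k g) :
    ContDiff ℝ k fun p : Fin (n + 1) → ℝ => g (Fin.tail p) :=
  hg.comp (contDiff_pi.mpr fun i => contDiff_apply ℝ ℝ i.succ)

theorem lineSecondDeriv_comp_tail (g : (Fin n → ℝ) → ℝ) (p ξ : Fin (n + 1) → ℝ) :
    lineSecondDeriv (fun q => g (Fin.tail q)) p ξ
      = lineSecondDeriv g (Fin.tail p) (Fin.tail ξ) := rfl

/-- The vector of horizontal translation by an integer vector. -/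
def latticeShift (k : Fin n → ℤ) : Fin (n + 1) → ℝ := Fin.cons 0 fun j => (k j : ℝ)

@[simp]
theorem latticeShift_zero (k : Fin n → ℤ) : latticeShift k 0 = 0 := rfl

@[simp]
theorem latticeShift_succ (k : Fin n → ℤ) (j : Fin n) : latticeShift k j.succ = k j := rfl

theorem tail_add_latticeShift (p : Fin (n + 1) → ℝ) (k : Fin n → ℤ) :
    Fin.tail (p + latticeShift k) = Fin.tail p + fun j => (k j : ℝ) := rfl

/-- Maximum principle on a periodic slab: a function which at every interior point has a
direction of strict convexity is bounded by its boundary values. -/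
theorem le_of_forall_exists_lineSecondDeriv_pos {d : (Fin (n + 1) → ℝ) → ℝ} {α β K : ℝ}
    (hd : Continuous d) (hper : ∀ p k, d (p + latticeShift k) = d p)
    (hα : ∀ p, p 0 = α → d p ≤ K) (hβ : ∀ p, p 0 = β → d p ≤ K)
    (hint : ∀ p, p 0 ∈ Set.Ioo α β → ∃ ξ, 0 < lineSecondDeriv d p ξ)
    (p : Fin (n + 1) → ℝ) (hp : p 0 ∈ Set.Icc α β) : d p ≤ K := by
  set S : Set (Fin (n + 1) → ℝ) := Set.Icc (Fin.cons α 0) (Fin.cons β 1) with hS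
  have hred : ∀ q : Fin (n + 1) → ℝ, q 0 ∈ Set.Icc α β → ∃ q' ∈ S, d q' = d q := by
    intro q hq
    refine ⟨q + latticeShift fun j => -⌊q j.succ⌋, ⟨fun i => ?_, fun i => ?_⟩, hper _ _⟩ <;>
      refine Fin.cases ?_ (fun j => ?_) i
    · simpa using hq.1
    · simpa using Int.floor_le (q j.succ)
    · simpa using hq.2
    · have := (Int.lt_floor_add_one (q j.succ)).le
      simp only [Pi.add_apply, latticeShift_succ, Fin.cons_succ, Pi.one_apply, Int.cast_neg]
      linarith
  have hS0 : ∀ q ∈ S, q 0 ∈ Set.Icc α β := fun q hq => ⟨hq.1 0, hq.2 0⟩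
  obtain ⟨p', hp', -⟩ := hred p hp
  obtain ⟨q, hqS, hq⟩ := isCompact_Icc.exists_isMaxOn ⟨p', hp'⟩ hd.continuousOn
  have hmax : ∀ z : Fin (n + 1) → ℝ, z 0 ∈ Set.Icc α β → d z ≤ d q := by
    intro z hz
    obtain ⟨z', hz', h⟩ := hred z hz
    exact h ▸ hq hz'
  refine (hmax p hp).trans ?_
  by_cases h0 : q 0 = α
  · exact hα q h0
  by_cases h1 : q 0 = β
  · exact hβ q h1
  have hqI : q 0 ∈ Set.Ioo α β :=
    ⟨lt_of_le_of_ne (hS0 q hqS).1 (Ne.symm h0), lt_of_le_of_ne (hS0 q hqS).2 h1⟩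
  obtain ⟨ξ, hξ⟩ := hint q hqI
  exfalso
  have hline : Continuous fun r : ℝ => q + r • ξ := by fun_prop
  have hlocmax : IsLocalMax (fun r : ℝ => d (q + r • ξ)) 0 := by
    have hc : Continuous fun r : ℝ => (q + r • ξ) 0 := (continuous_apply 0).comp hline
    filter_upwards [hc.continuousAt.eventually_mem
      (Ioo_mem_nhds (a := α) (b := β) (by simpa using hqI.1) (by simpa using hqI.2))] with r hr
    simpa using hmax _ ⟨hr.1.le, hr.2.le⟩
  have hlocmin := isLocalMin_of_deriv_deriv_pos hξ hlocmax.deriv_eq_zero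
    (hd.comp hline).continuousAt
  have hconst : (fun r : ℝ => d (q + r • ξ)) =ᶠ[nhds 0] fun _ => d (q + (0 : ℝ) • ξ) := by
    filter_upwards [hlocmax, hlocmin] with r h1 h2
    exact le_antisymm h1 h2
  rw [lineSecondDeriv, hconst.deriv.deriv_eq] at hξ
  simp at hξ

/-- Comparison principle for the phase operator on a periodic slab. -/
theorem sub_le_of_lagPhase_le {a b : (Fin (n + 1) → ℝ) → ℝ} {α β K : ℝ}
    (ha : ContDiff ℝ 2 a) (hb : ContDiff ℝ 2 b)
    (hper : ∀ p k, a (p + latticeShift k) - b (p + latticeShift k) = a p - b p)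
    (hphase : ∀ p, p 0 ∈ Set.Ioo α β → lagPhase (hess b p) ≤ lagPhase (hess a p))
    (hα : ∀ p, p 0 = α → a p - b p ≤ K) (hβ : ∀ p, p 0 = β → a p - b p ≤ K)
    (p : Fin (n + 1) → ℝ) (hp : p 0 ∈ Set.Icc α β) : a p - b p ≤ K := by
  have key : ∀ ε > 0, a p - b p ≤ K + ε * (α ^ 2 + β ^ 2) := by
    intro ε hε
    have hq : ContDiff ℝ 2 (heightQuadratic (n := n) ε 0 0) := contDiff_heightQuadratic _ _ _
    have hbd : ∀ q : Fin (n + 1) → ℝ, heightQuadratic ε 0 0 q = ε * q 0 ^ 2 := fun q => by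
      simp [heightQuadratic]
    have h := le_of_forall_exists_lineSecondDeriv_pos (α := α) (β := β)
      (d := fun q => (a q - b q) + heightQuadratic ε 0 0 q) (K := K + ε * (α ^ 2 + β ^ 2))
      ((ha.sub hb).add hq).continuous
      (fun q k => by simp [hbd, hper]) ?_ ?_ ?_ p hp
    · rw [hbd] at h
      nlinarith [sq_nonneg (p 0)]
    · intro q hq0
      rw [hbd, hq0]
      nlinarith [hα q hq0, sq_nonneg β]
    · intro q hq0
      rw [hbd, hq0]
      nlinarith [hβ q hq0, sq_nonneg α]
    · intro q hq0
      by_contra! hcon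
      have hQ : ∀ ξ, lineSecondDeriv a q ξ + 2 * ε * ξ 0 ^ 2 ≤ lineSecondDeriv b q ξ := by
        intro ξ
        have := hcon ξ
        rw [lineSecondDeriv_add (ha.sub hb) hq, lineSecondDeriv_sub ha hb,
          lineSecondDeriv_heightQuadratic] at this
        linarith
      have hle : ∀ ξ, lineSecondDeriv a q ξ ≤ lineSecondDeriv b q ξ := fun ξ => by
        nlinarith [hQ ξ, sq_nonneg (ξ 0)]
      refine (hphase q hq0).not_gt (lagPhase_strictMono (hess_isHermitian ha q)
        (hess_isHermitian hb q) (fun ξ => ?_) ?_)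
      · rw [← lineSecondDeriv_eq_dotProduct ha, ← lineSecondDeriv_eq_dotProduct hb]
        exact hle ξ
      · rw [trace_hess ha, trace_hess hb]
        refine Finset.sum_lt_sum (fun i _ => hle _) ⟨0, Finset.mem_univ _, ?_⟩
        have := hQ (Pi.single 0 1)
        simp only [Pi.single_eq_same] at this
        linarith
  by_contra! hcon
  have hM : 0 < α ^ 2 + β ^ 2 + 1 := by positivity
  have h := key ((a p - b p - K) / (α ^ 2 + β ^ 2 + 1)) (by apply div_pos <;> linarith)
  have h2 : (a p - b p - K) / (α ^ 2 + β ^ 2 + 1) * (α ^ 2 + β ^ 2) < a p - b p - K := by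
    rw [div_mul_eq_mul_div, div_lt_iff₀ hM]
    nlinarith
  linarith

/-- A function of the horizontal variables plus a convex quadratic function of the height
is a lower barrier. -/
theorem add_heightQuadratic_le {u : (Fin (n + 1) → ℝ) → ℝ} {g : (Fin n → ℝ) → ℝ} {σ b c e Θ : ℝ}
    (hu : ContDiff ℝ 2 u) (hg : ContDiff ℝ 2 g)
    (hper : ∀ p k, u (p + latticeShift k) - g (Fin.tail (p + latticeShift k))
      = u p - g (Fin.tail p))
    (hphase : ∀ p, p 0 ∈ Set.Ioo 0 σ → lagPhase (hess u p) = Θ)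
    (hb : ∀ x, Θ ≤ Real.arctan (2 * b) + lagPhase (hess g x))
    (h0 : ∀ p, p 0 = 0 → g (Fin.tail p) + heightQuadratic b c e p ≤ u p)
    (h1 : ∀ p, p 0 = σ → g (Fin.tail p) + heightQuadratic b c e p ≤ u p)
    (p : Fin (n + 1) → ℝ) (hp : p 0 ∈ Set.Icc 0 σ) :
    g (Fin.tail p) + heightQuadratic b c e p ≤ u p := by
  have hg' := contDiff_comp_tail hg
  have hq : ContDiff ℝ 2 (heightQuadratic (n := n) b c e) := contDiff_heightQuadratic _ _ _
  have hw : ContDiff ℝ 2 fun p : Fin (n + 1) → ℝ =>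
      g (Fin.tail p) + heightQuadratic b c e p := hg'.add hq
  have h := sub_le_of_lagPhase_le (α := 0) (β := σ) (K := 0) hw hu ?_ ?_ ?_ ?_ p hp
  · linarith
  · intro q k
    have hk := hper q k
    simp only [heightQuadratic, Pi.add_apply, latticeShift_zero, add_zero]
    linarith
  · intro q hq0
    rw [hphase q hq0]
    refine (hb (Fin.tail q)).trans ?_
    rw [← lagPhase_consDiag (hess_isHermitian hg _)]
    refine lagPhase_mono (consDiag_isHermitian (hess_isHermitian hg _)) (hess_isHermitian hw q)
      fun ξ => ?_
    rw [← lineSecondDeriv_eq_dotProduct hw, lineSecondDeriv_add hg' hq,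
      lineSecondDeriv_comp_tail, lineSecondDeriv_heightQuadratic, dotProduct_consDiag_mulVec,
      lineSecondDeriv_eq_dotProduct hg]
    linarith
  · intro q hq0
    linarith [h0 q hq0]
  · intro q hq0
    linarith [h1 q hq0]

end Slab

section Periodic

variable {n : ℕ} {f g : (Fin n → ℝ) → ℝ}

theorem exists_forall_le_of_periodic (hf : LowerSemicontinuous f)
    (hper : ∀ (x : Fin n → ℝ) (k : Fin n → ℤ), f (x + fun j => (k j : ℝ)) = f x) :
    ∃ x₀, ∀ x, f x₀ ≤ f x := by
  obtain ⟨x₀, -, hx₀⟩ := LowerSemicontinuousOn.exists_isMinOn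
    (s := Set.Icc (0 : Fin n → ℝ) 1) ⟨0, by simp⟩ isCompact_Icc
    (hf.lowerSemicontinuousOn _)
  refine ⟨x₀, fun x => ?_⟩
  have h := hx₀ (a := x + fun j => ((-⌊x j⌋ : ℤ) : ℝ)) ⟨fun j => ?_, fun j => ?_⟩
  · rw [Set.mem_ofPred_eq, hper x fun j => -⌊x j⌋] at h
    exact h
  · simpa using Int.floor_le (x j)
  · have := (Int.lt_floor_add_one (x j)).le
    simp only [Pi.add_apply, Pi.one_apply, Int.cast_neg]
    linarith

theorem exists_forall_lt_of_periodic (hf : Continuous f)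
    (hper : ∀ (x : Fin n → ℝ) (k : Fin n → ℤ), f (x + fun j => (k j : ℝ)) = f x) :
    ∃ K, 0 ≤ K ∧ ∀ x, f x < K := by
  obtain ⟨x₀, hx₀⟩ := exists_forall_le_of_periodic (f := fun x => -f x)
    hf.neg.lowerSemicontinuous fun x k => by rw [hper]
  refine ⟨|f x₀| + 1, by positivity, fun x => ?_⟩
  have h1 := hx₀ x
  have h2 := le_abs_self (f x₀)
  linarith

theorem hess_add_of_fderiv_add {y : Fin n → ℝ} (h : ∀ x, fderiv ℝ g (x + y) = fderiv ℝ g x)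
    (x : Fin n → ℝ) : hess g (x + y) = hess g x := by
  ext i j
  simp only [hess, Matrix.of_apply]
  rw [← fderiv_comp_add_right (f := fun z => fderiv ℝ g z (Pi.single j 1))]
  simp only [h]

open Matrix in
theorem lowerSemicontinuous_lagPhase_hess (hg : ContDiff ℝ 2 g) :
    LowerSemicontinuous fun x => lagPhase (hess g x) := by
  intro x c hc
  obtain ⟨η, hη, h⟩ := exists_lagPhase_gt_of_dotProduct_le (hess_isHermitian hg x) hc
  have hev : ∀ᶠ z in nhds x, ∀ i j, |hess g x i j - hess g z i j| < η / (n + 1) := by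
    refine Filter.eventually_all.mpr fun i => Filter.eventually_all.mpr fun j => ?_
    have hcont : Continuous fun z => |hess g x i j - hess g z i j| :=
      (continuous_const.sub (continuous_hess_apply hg i j)).abs
    exact hcont.continuousAt.eventually_lt_const (by simp only [sub_self, abs_zero]; positivity)
  filter_upwards [hev] with z hz
  refine h _ (hess_isHermitian hg z) fun ξ => ?_
  have hterm : ∀ i j, ξ i * ((hess g x i j - hess g z i j) * ξ j)
      ≤ η / (n + 1) * ((ξ i ^ 2 + ξ j ^ 2) / 2) := by
    intro i j
    have h1 : |ξ i * ξ j| ≤ (ξ i ^ 2 + ξ j ^ 2) / 2 := by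
      rw [abs_le]
      constructor <;> nlinarith [sq_nonneg (ξ i + ξ j), sq_nonneg (ξ i - ξ j)]
    calc ξ i * ((hess g x i j - hess g z i j) * ξ j)
        ≤ |ξ i * ((hess g x i j - hess g z i j) * ξ j)| := le_abs_self _
      _ = |hess g x i j - hess g z i j| * |ξ i * ξ j| := by simp only [abs_mul]; ring
      _ ≤ _ := mul_le_mul (hz i j).le h1 (abs_nonneg _) (by positivity)
  have hsum : ∑ i, ∑ j, ξ i * ((hess g x i j - hess g z i j) * ξ j)
      ≤ η / (n + 1) * (n * (ξ ⬝ᵥ ξ)) := by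
    refine (Finset.sum_le_sum fun i _ => Finset.sum_le_sum fun j _ => hterm i j).trans_eq ?_
    simp only [← Finset.mul_sum, ← Finset.sum_div, Finset.sum_add_distrib, Finset.sum_const,
      Finset.card_univ, Fintype.card_fin, nsmul_eq_mul, dotProduct, ← sq]
    ring
  have heq : ∑ i, ∑ j, ξ i * ((hess g x i j - hess g z i j) * ξ j)
      = ξ ⬝ᵥ hess g x *ᵥ ξ - ξ ⬝ᵥ hess g z *ᵥ ξ := by
    simp only [dotProduct, mulVec, Finset.mul_sum, ← Finset.sum_sub_distrib]
    refine Finset.sum_congr rfl fun i _ => Finset.sum_congr rfl fun j _ => ?_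
    ring
  have hξ : 0 ≤ ξ ⬝ᵥ ξ := Finset.sum_nonneg fun j _ => mul_self_nonneg _
  have hfin : η / (n + 1) * (n * (ξ ⬝ᵥ ξ)) ≤ η * (ξ ⬝ᵥ ξ) := by
    rw [← mul_assoc]
    refine mul_le_mul_of_nonneg_right ?_ hξ
    rw [div_mul_eq_mul_div, div_le_iff₀ (by positivity)]
    nlinarith
  linarith

theorem exists_add_eq_of_fderiv_add (hg : Differentiable ℝ g)
    (hper : ∀ (x : Fin n → ℝ) (k : Fin n → ℤ),
      fderiv ℝ g (x + fun j => (k j : ℝ)) = fderiv ℝ g x) (k : Fin n → ℤ) :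
    ∃ c, ∀ x, g (x + fun j => (k j : ℝ)) = g x + c := by
  set y : Fin n → ℝ := fun j => (k j : ℝ) with hy
  have hd : Differentiable ℝ fun x => g (x + y) := hg.comp (differentiable_id.add_const y)
  have hconst := is_const_of_fderiv_eq_zero (𝕜 := ℝ) (f := fun x => g (x + y) - g x) (hd.sub hg)
    fun x => by
      rw [fderiv_fun_sub (hd x) (hg x), fderiv_comp_add_right, hper, sub_self]
  refine ⟨g (0 + y) - g 0, fun x => ?_⟩
  have := hconst x 0
  linarith

theorem exists_lipschitz_of_fderiv_add (hg : ContDiff ℝ 2 g)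
    (hper : ∀ (x : Fin n → ℝ) (k : Fin n → ℤ),
      fderiv ℝ g (x + fun j => (k j : ℝ)) = fderiv ℝ g x) :
    ∃ L, 0 ≤ L ∧ ∀ x y, |g (x + y) - g x| ≤ L * ‖y‖ := by
  obtain ⟨L, hL0, hL⟩ := exists_forall_lt_of_periodic (f := fun x => ‖fderiv ℝ g x‖)
    (hg.continuous_fderiv (by norm_num)).norm fun x k => by rw [hper]
  refine ⟨L, hL0, fun x y => ?_⟩
  simpa using convex_univ.norm_image_sub_le_of_norm_fderiv_le
    (fun z _ => hg.differentiable (by norm_num) z) (fun z _ => (hL z).le)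
    (Set.mem_univ x) (Set.mem_univ (x + y))

theorem exists_forall_le_arctan_add_lagPhase (hg : ContDiff ℝ 2 g)
    (hper : ∀ (x : Fin n → ℝ) (k : Fin n → ℤ),
      fderiv ℝ g (x + fun j => (k j : ℝ)) = fderiv ℝ g x)
    {Θ : ℝ} (hphase : ∀ x, Θ - Real.pi / 2 < lagPhase (hess g x)) :
    ∃ B, 0 ≤ B ∧ ∀ x, Θ ≤ Real.arctan (2 * B) + lagPhase (hess g x) := by
  obtain ⟨x₀, hx₀⟩ := exists_forall_le_of_periodic (lowerSemicontinuous_lagPhase_hess hg)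
    fun x k => by rw [hess_add_of_fderiv_add fun z => hper z k]
  have hlim : Filter.Tendsto (fun B : ℝ => Real.arctan (2 * B)) Filter.atTop
      (nhds (Real.pi / 2)) :=
    (Real.tendsto_arctan_atTop.mono_right nhdsWithin_le_nhds).comp
      (Filter.tendsto_id.const_mul_atTop two_pos)
  obtain ⟨B, hB, hB0⟩ := ((hlim.eventually_const_lt
    (show Θ - lagPhase (hess g x₀) < Real.pi / 2 by linarith [hphase x₀])).and
      (Filter.eventually_ge_atTop 0)).exists
  exact ⟨B, hB0, fun x => by linarith [hx₀ x]⟩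

theorem exists_forall_trace_hess_lt (hg : ContDiff ℝ 2 g)
    (hper : ∀ (x : Fin n → ℝ) (k : Fin n → ℤ),
      fderiv ℝ g (x + fun j => (k j : ℝ)) = fderiv ℝ g x) :
    ∃ K, 0 ≤ K ∧ ∀ x, (hess g x).trace < K :=
  exists_forall_lt_of_periodic (continuous_finsetSum _ fun i _ => continuous_hess_apply hg i i)
    fun x k => by rw [hess_add_of_fderiv_add fun z => hper z k]

end Periodic

section Dirichlet

variable {n : ℕ} {u₀ u₁ : (Fin n → ℝ) → ℝ} {Θ D L K B σ : ℝ} {v : (Fin (n + 1) → ℝ) → ℝ}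

/-- Quantitative bounds on the boundary data `u₀`, `u₁`. -/
structure BoundaryBounds (u₀ u₁ : (Fin n → ℝ) → ℝ) (Θ D L K B : ℝ) : Prop where
  contDiff₀ : ContDiff ℝ 2 u₀
  contDiff₁ : ContDiff ℝ 2 u₁
  shift : ∀ k : Fin n → ℤ, ∃ c, ∀ x, u₀ (x + fun j => (k j : ℝ)) = u₀ x + c ∧
    u₁ (x + fun j => (k j : ℝ)) = u₁ x + c
  diff_le : ∀ x, |u₁ x - u₀ x| ≤ D
  lip₀ : ∀ x y, |u₀ (x + y) - u₀ x| ≤ L * ‖y‖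
  lip₁ : ∀ x y, |u₁ (x + y) - u₁ x| ≤ L * ‖y‖
  trace₀ : ∀ x, (hess u₀ x).trace < K
  trace₁ : ∀ x, (hess u₁ x).trace < K
  phase₀ : ∀ x, Θ ≤ Real.arctan (2 * B) + lagPhase (hess u₀ x)
  phase₁ : ∀ x, Θ ≤ Real.arctan (2 * B) + lagPhase (hess u₁ x)
  L_nonneg : 0 ≤ L
  K_nonneg : 0 ≤ K
  B_nonneg : 0 ≤ B

theorem exists_boundaryBounds (hu₀ : ContDiff ℝ 2 u₀) (hu₁ : ContDiff ℝ 2 u₁)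
    (hper₀ : ∀ (x : Fin n → ℝ) (k : Fin n → ℤ),
      fderiv ℝ u₀ (x + fun j => (k j : ℝ)) = fderiv ℝ u₀ x)
    (hper₁ : ∀ (x : Fin n → ℝ) (k : Fin n → ℤ),
      fderiv ℝ u₁ (x + fun j => (k j : ℝ)) = fderiv ℝ u₁ x)
    (hdiff : ∀ (x : Fin n → ℝ) (k : Fin n → ℤ),
      u₁ (x + fun j => (k j : ℝ)) - u₀ (x + fun j => (k j : ℝ)) = u₁ x - u₀ x)
    (hphase₀ : ∀ x, Θ - Real.pi / 2 < lagPhase (hess u₀ x))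
    (hphase₁ : ∀ x, Θ - Real.pi / 2 < lagPhase (hess u₁ x)) :
    ∃ D L K B, BoundaryBounds u₀ u₁ Θ D L K B := by
  obtain ⟨D, -, hD⟩ := exists_forall_lt_of_periodic (f := fun x => |u₁ x - u₀ x|)
    (hu₁.continuous.sub hu₀.continuous).abs fun x k => by rw [hdiff]
  obtain ⟨L₀, hL₀, hlip₀⟩ := exists_lipschitz_of_fderiv_add hu₀ hper₀
  obtain ⟨L₁, -, hlip₁⟩ := exists_lipschitz_of_fderiv_add hu₁ hper₁
  obtain ⟨K₀, hK₀, htr₀⟩ := exists_forall_trace_hess_lt hu₀ hper₀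
  obtain ⟨K₁, -, htr₁⟩ := exists_forall_trace_hess_lt hu₁ hper₁
  obtain ⟨B₀, hB₀, hph₀⟩ := exists_forall_le_arctan_add_lagPhase hu₀ hper₀ hphase₀
  obtain ⟨B₁, -, hph₁⟩ := exists_forall_le_arctan_add_lagPhase hu₁ hper₁ hphase₁
  refine ⟨D, max L₀ L₁, max K₀ K₁, max B₀ B₁, hu₀, hu₁, fun k => ?_, fun x => (hD x).le,
    fun x y => (hlip₀ x y).trans (by gcongr; exact le_max_left _ _),
    fun x y => (hlip₁ x y).trans (by gcongr; exact le_max_right _ _),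
    fun x => (htr₀ x).trans_le (le_max_left _ _), fun x => (htr₁ x).trans_le (le_max_right _ _),
    fun x => (hph₀ x).trans ?_, fun x => (hph₁ x).trans ?_,
    le_max_of_le_left hL₀, le_max_of_le_left hK₀, le_max_of_le_left hB₀⟩
  · obtain ⟨c, hc⟩ := exists_add_eq_of_fderiv_add (hu₀.differentiable (by norm_num)) hper₀ k
    exact ⟨c, fun x => ⟨hc x, by linarith [hdiff x k, hc x]⟩⟩
  · gcongr
    exact le_max_left _ _
  · gcongr
    exact le_max_right _ _

/-- The affine interpolation between `u₀` at height `0` and `u₁` at height `σ`. -/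
noncomputable def interpolation (u₀ u₁ : (Fin n → ℝ) → ℝ) (σ : ℝ) (p : Fin (n + 1) → ℝ) : ℝ :=
  (1 - p 0 / σ) * u₀ (Fin.tail p) + (p 0 / σ) * u₁ (Fin.tail p)

theorem contDiff_interpolation {k : WithTop ℕ∞} (hu₀ : ContDiff ℝ k u₀) (hu₁ : ContDiff ℝ k u₁) :
    ContDiff ℝ k (interpolation u₀ u₁ σ) := by
  have h : ContDiff ℝ k fun p : Fin (n + 1) → ℝ => p 0 / σ :=
    (contDiff_apply ℝ ℝ 0).div_const σ
  exact ((contDiff_const.sub h).mul (contDiff_comp_tail hu₀)).add (h.mul (contDiff_comp_tail hu₁))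

theorem lineSecondDeriv_interpolation_zero (p : Fin (n + 1) → ℝ) :
    lineSecondDeriv (interpolation u₀ u₁ σ) p (Pi.single 0 1) = 0 := by
  have h : (fun r : ℝ => interpolation u₀ u₁ σ (p + r • Pi.single 0 1)) = fun r =>
      0 * r ^ 2 + ((u₁ (Fin.tail p) - u₀ (Fin.tail p)) / σ) * r + interpolation u₀ u₁ σ p := by
    ext r
    have ht : Fin.tail (p + r • (Pi.single 0 1 : Fin (n + 1) → ℝ)) = Fin.tail p := by
      ext j
      simp [Fin.tail]
    simp only [interpolation, ht, Pi.add_apply, Pi.smul_apply, Pi.single_eq_same, smul_eq_mul]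
    ring
  rw [lineSecondDeriv, h, deriv_deriv_quadratic, mul_zero]

theorem lineSecondDeriv_interpolation_succ (hu₀ : ContDiff ℝ 2 u₀) (hu₁ : ContDiff ℝ 2 u₁)
    (p : Fin (n + 1) → ℝ) (i : Fin n) :
    lineSecondDeriv (interpolation u₀ u₁ σ) p (Pi.single i.succ 1)
      = (1 - p 0 / σ) * lineSecondDeriv u₀ (Fin.tail p) (Pi.single i 1)
        + (p 0 / σ) * lineSecondDeriv u₁ (Fin.tail p) (Pi.single i 1) := by
  rw [← lineSecondDeriv_const_mul, ← lineSecondDeriv_const_mul,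
    ← lineSecondDeriv_add (contDiff_const.mul hu₀) (contDiff_const.mul hu₁)]
  unfold lineSecondDeriv
  congr 2
  ext r
  have ht : Fin.tail (p + r • (Pi.single i.succ 1 : Fin (n + 1) → ℝ))
      = Fin.tail p + r • Pi.single i 1 := by
    ext j
    simp [Fin.tail, Pi.single_apply]
  simp [interpolation, ht]

/-- Solutions of the Dirichlet problem with zero boundary values on the slab of height `σ`,
relative to the interpolation of `u₀` and `u₁`. -/
structure IsDirichletSolution (u₀ u₁ : (Fin n → ℝ) → ℝ) (Θ σ : ℝ)
    (v : (Fin (n + 1) → ℝ) → ℝ) : Prop where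
  contDiff : ContDiff ℝ 2 v
  periodic : ∀ p k, v (p + latticeShift k) = v p
  bot : ∀ p, p 0 = 0 → v p = 0
  top : ∀ p, p 0 = σ → v p = 0
  phase : ∀ p, p 0 ∈ Set.Icc 0 σ →
    lagPhase (hess (fun q => interpolation u₀ u₁ σ q + v q) p) = Θ

namespace IsDirichletSolution

theorem contDiff_add (hv : IsDirichletSolution u₀ u₁ Θ σ v)
    (hb : BoundaryBounds u₀ u₁ Θ D L K B) :
    ContDiff ℝ 2 fun q => interpolation u₀ u₁ σ q + v q :=
  (contDiff_interpolation hb.contDiff₀ hb.contDiff₁).add hv.contDiff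

theorem add_latticeShift (hv : IsDirichletSolution u₀ u₁ Θ σ v)
    (hb : BoundaryBounds u₀ u₁ Θ D L K B) (k : Fin n → ℤ) :
    ∃ c, ∀ p, interpolation u₀ u₁ σ (p + latticeShift k) + v (p + latticeShift k)
        = interpolation u₀ u₁ σ p + v p + c ∧
      u₀ (Fin.tail (p + latticeShift k)) = u₀ (Fin.tail p) + c ∧
      u₁ (Fin.tail (p + latticeShift k)) = u₁ (Fin.tail p) + c := by
  obtain ⟨c, hc⟩ := hb.shift k
  refine ⟨c, fun p => ⟨?_, (hc _).1, (hc _).2⟩⟩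
  rw [hv.periodic, interpolation, interpolation, tail_add_latticeShift, (hc _).1, (hc _).2]
  simp only [Pi.add_apply, latticeShift_zero]
  ring

theorem le_mul (hv : IsDirichletSolution u₀ u₁ Θ σ v) (hb : BoundaryBounds u₀ u₁ Θ D L K B)
    (hn : 1 ≤ n) (hΘ : ((n : ℝ) - 1) * Real.pi / 2 ≤ Θ) (hσ : 0 < σ)
    (p : Fin (n + 1) → ℝ) (hp : p 0 ∈ Set.Icc 0 σ) : v p ≤ K / 2 * (p 0 * (σ - p 0)) := by
  have hq : ContDiff ℝ 2 (heightQuadratic (n := n) (K / 2) (-(K / 2 * σ)) 0) :=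
    contDiff_heightQuadratic _ _ _
  have hqe : ∀ q : Fin (n + 1) → ℝ, heightQuadratic (K / 2) (-(K / 2 * σ)) 0 q
      = -(K / 2 * (q 0 * (σ - q 0))) := fun q => by
    simp only [heightQuadratic]
    ring
  have h := le_of_forall_exists_lineSecondDeriv_pos (α := 0) (β := σ) (K := 0)
    (d := fun q => v q + heightQuadratic (K / 2) (-(K / 2 * σ)) 0 q)
    (hv.contDiff.add hq).continuous (fun q k => by simp [hqe, hv.periodic]) ?_ ?_ ?_ p hp
  · rw [hqe] at h
    linarith
  · intro q hq0
    rw [hqe, hv.bot q hq0, hq0]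
    simp
  · intro q hq0
    rw [hqe, hv.top q hq0, hq0]
    simp
  · intro q hq0
    by_contra! hcon
    have hQ : ∀ ξ, lineSecondDeriv v q ξ + K * ξ 0 ^ 2 ≤ 0 := by
      intro ξ
      have := hcon ξ
      rw [lineSecondDeriv_add hv.contDiff hq, lineSecondDeriv_heightQuadratic] at this
      linarith
    have htr : 0 ≤ (hess (fun q => interpolation u₀ u₁ σ q + v q) q).trace := by
      refine trace_nonneg_of_le_lagPhase (hess_isHermitian (hv.contDiff_add hb) q)
        (by rw [Fintype.card_fin]; omega) ?_
      rw [hv.phase q ⟨hq0.1.le, hq0.2.le⟩, Fintype.card_fin]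
      refine le_trans (le_of_eq ?_) hΘ
      push_cast
      ring
    rw [trace_hess (hv.contDiff_add hb), Fin.sum_univ_succ] at htr
    simp only [lineSecondDeriv_add (contDiff_interpolation hb.contDiff₀ hb.contDiff₁) hv.contDiff,
      lineSecondDeriv_interpolation_zero,
      lineSecondDeriv_interpolation_succ hb.contDiff₀ hb.contDiff₁, Finset.sum_add_distrib,
      ← Finset.mul_sum, ← trace_hess hb.contDiff₀, ← trace_hess hb.contDiff₁] at htr
    have h0 := hQ (Pi.single 0 1)
    simp only [Pi.single_eq_same] at h0
    have hs : ∑ i : Fin n, lineSecondDeriv v q (Pi.single i.succ 1) ≤ 0 :=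
      Finset.sum_nonpos fun i _ => by simpa using hQ (Pi.single i.succ 1)
    have ht0 : 0 < q 0 / σ := div_pos hq0.1 hσ
    have ht1 : q 0 / σ < 1 := (div_lt_one hσ).mpr hq0.2
    nlinarith [mul_pos ht0 (sub_pos.mpr (hb.trace₁ (Fin.tail q))),
      mul_pos (sub_pos.mpr ht1) (sub_pos.mpr (hb.trace₀ (Fin.tail q)))]

theorem neg_le_bot (hv : IsDirichletSolution u₀ u₁ Θ σ v) (hb : BoundaryBounds u₀ u₁ Θ D L K B)
    (hσ : 0 < σ) (hσ1 : σ ≤ 1) (p : Fin (n + 1) → ℝ) (hp : p 0 ∈ Set.Icc 0 σ) :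
    -((B + 2 * D) * (p 0 / σ)) ≤ v p := by
  have hqe : ∀ q : Fin (n + 1) → ℝ, heightQuadratic (B / σ ^ 2) (-((B + D) / σ)) 0 q
      = B * (q 0 / σ) ^ 2 - (B + D) * (q 0 / σ) := fun q => by
    simp only [heightQuadratic]
    ring
  have h := add_heightQuadratic_le (σ := σ) (b := B / σ ^ 2) (c := -((B + D) / σ)) (e := 0) (Θ := Θ)
    (hv.contDiff_add hb) hb.contDiff₀ ?_ (fun q hq => hv.phase q ⟨hq.1.le, hq.2.le⟩) ?_ ?_ ?_ p hp
  · rw [hqe, interpolation] at h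
    have hD := abs_le.mp (hb.diff_le (Fin.tail p))
    have ht0 : 0 ≤ p 0 / σ := div_nonneg hp.1 hσ.le
    nlinarith [mul_nonneg ht0 (sub_nonneg.mpr hD.2), mul_nonneg hb.B_nonneg (sq_nonneg (p 0 / σ))]
  · intro q k
    obtain ⟨c, hc⟩ := hv.add_latticeShift hb k
    obtain ⟨h1, h2, -⟩ := hc q
    linarith
  · intro x
    refine (hb.phase₀ x).trans ?_
    gcongr
    exact le_div_self hb.B_nonneg (by positivity) (pow_le_one₀ hσ.le hσ1)
  · intro q hq0
    rw [hqe, interpolation, hv.bot q hq0, hq0]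
    simp
  · intro q hq0
    have hD := abs_le.mp (hb.diff_le (Fin.tail q))
    rw [hqe, interpolation, hv.top q hq0, hq0, div_self hσ.ne']
    linarith

theorem neg_le_top (hv : IsDirichletSolution u₀ u₁ Θ σ v) (hb : BoundaryBounds u₀ u₁ Θ D L K B)
    (hσ : 0 < σ) (hσ1 : σ ≤ 1) (p : Fin (n + 1) → ℝ) (hp : p 0 ∈ Set.Icc 0 σ) :
    -((B + 2 * D) * (1 - p 0 / σ)) ≤ v p := by
  have hqe : ∀ q : Fin (n + 1) → ℝ, heightQuadratic (B / σ ^ 2) ((-B + D) / σ) (-D) q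
      = B * (1 - q 0 / σ) ^ 2 - (B + D) * (1 - q 0 / σ) := fun q => by
    simp only [heightQuadratic]
    ring
  have h := add_heightQuadratic_le (σ := σ) (b := B / σ ^ 2) (c := (-B + D) / σ) (e := -D) (Θ := Θ)
    (hv.contDiff_add hb) hb.contDiff₁ ?_ (fun q hq => hv.phase q ⟨hq.1.le, hq.2.le⟩) ?_ ?_ ?_ p hp
  · rw [hqe, interpolation] at h
    have hD := abs_le.mp (hb.diff_le (Fin.tail p))
    have ht1 : 0 ≤ 1 - p 0 / σ := sub_nonneg.mpr ((div_le_one hσ).mpr hp.2)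
    nlinarith [mul_nonneg ht1 (neg_le_iff_add_nonneg.mp hD.1),
      mul_nonneg hb.B_nonneg (sq_nonneg (1 - p 0 / σ))]
  · intro q k
    obtain ⟨c, hc⟩ := hv.add_latticeShift hb k
    obtain ⟨h1, -, h2⟩ := hc q
    linarith
  · intro x
    refine (hb.phase₁ x).trans ?_
    gcongr
    exact le_div_self hb.B_nonneg (by positivity) (pow_le_one₀ hσ.le hσ1)
  · intro q hq0
    have hD := abs_le.mp (hb.diff_le (Fin.tail q))
    rw [hqe, interpolation, hv.bot q hq0, hq0, zero_div]
    linarith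
  · intro q hq0
    rw [hqe, interpolation, hv.top q hq0, hq0, div_self hσ.ne']
    simp

theorem abs_le_bot_top (hv : IsDirichletSolution u₀ u₁ Θ σ v)
    (hb : BoundaryBounds u₀ u₁ Θ D L K B) (hn : 1 ≤ n)
    (hΘ : ((n : ℝ) - 1) * Real.pi / 2 ≤ Θ) (hσ : 0 < σ) (hσ1 : σ ≤ 1)
    (p : Fin (n + 1) → ℝ) (hp : p 0 ∈ Set.Icc 0 σ) :
    |v p| ≤ (B + 2 * D + K) * (p 0 / σ) ∧ |v p| ≤ (B + 2 * D + K) * (1 - p 0 / σ) := by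
  have hup := hv.le_mul hb hn hΘ hσ p hp
  have ht0 : 0 ≤ p 0 / σ := div_nonneg hp.1 hσ.le
  have ht1 : 0 ≤ 1 - p 0 / σ := sub_nonneg.mpr ((div_le_one hσ).mpr hp.2)
  have hK := hb.K_nonneg
  have hBD : 0 ≤ B + 2 * D := by
    linarith [hb.B_nonneg, (abs_nonneg _).trans (hb.diff_le (Fin.tail p))]
  have heq : p 0 * (σ - p 0) = σ ^ 2 * (p 0 / σ * (1 - p 0 / σ)) := by
    field_simp
  have hmul : p 0 * (σ - p 0) ≤ p 0 / σ * (1 - p 0 / σ) := by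
    rw [heq]
    exact mul_le_of_le_one_left (mul_nonneg ht0 ht1) (pow_le_one₀ hσ.le hσ1)
  have hup' : v p ≤ K * (p 0 / σ * (1 - p 0 / σ)) := by
    nlinarith [mul_nonneg hK (mul_nonneg ht0 ht1)]
  have hpK0 := mul_nonneg hK ht0
  have hpK1 := mul_nonneg hK ht1
  have hpB0 := mul_nonneg hBD ht0
  have hpB1 := mul_nonneg hBD ht1
  constructor <;> rw [abs_le] <;> constructor
  · linarith [hv.neg_le_bot hb hσ hσ1 p hp]
  · nlinarith [mul_nonneg hpK0 ht0]
  · linarith [hv.neg_le_top hb hσ hσ1 p hp]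
  · nlinarith [mul_nonneg hpK1 ht1]

theorem horizontal_sub_le (hv : IsDirichletSolution u₀ u₁ Θ σ v)
    (hb : BoundaryBounds u₀ u₁ Θ D L K B) (hσ : 0 < σ) (y : Fin n → ℝ)
    (p : Fin (n + 1) → ℝ) (hp : p 0 ∈ Set.Icc 0 σ) :
    interpolation u₀ u₁ σ (p + Fin.cons 0 y) + v (p + Fin.cons 0 y)
      - (interpolation u₀ u₁ σ p + v p) ≤ L * ‖y‖ := by
  set w : Fin (n + 1) → ℝ := Fin.cons 0 y with hw
  have hw0 : ∀ q : Fin (n + 1) → ℝ, (q + w) 0 = q 0 := fun q => by simp [hw]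
  have hwt : ∀ q : Fin (n + 1) → ℝ, Fin.tail (q + w) = Fin.tail q + y := fun q => rfl
  have hu := hv.contDiff_add hb
  refine sub_le_of_lagPhase_le (α := 0) (β := σ)
    (a := fun q => interpolation u₀ u₁ σ (q + w) + v (q + w))
    (hu.comp (contDiff_id.add contDiff_const)) hu ?_ ?_ ?_ ?_ p hp
  · intro q k
    obtain ⟨c, hc⟩ := hv.add_latticeShift hb k
    have h := (hc (q + w)).1
    rw [add_right_comm] at h
    linarith [(hc q).1]
  · intro q hq
    have hq' : q 0 ∈ Set.Icc 0 σ := ⟨hq.1.le, hq.2.le⟩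
    rw [hess_comp_add_right (fun q => interpolation u₀ u₁ σ q + v q), hv.phase q hq',
      hv.phase (q + w) (by rwa [hw0])]
  · intro q hq
    rw [hv.bot q hq, hv.bot (q + w) (by rwa [hw0]), interpolation, interpolation, hw0, hwt, hq]
    simpa using (le_abs_self _).trans (hb.lip₀ (Fin.tail q) y)
  · intro q hq
    rw [hv.top q hq, hv.top (q + w) (by rwa [hw0]), interpolation, interpolation, hw0, hwt, hq,
      div_self hσ.ne']
    simpa using (le_abs_self _).trans (hb.lip₁ (Fin.tail q) y)

theorem abs_horizontal_sub_le (hv : IsDirichletSolution u₀ u₁ Θ σ v)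
    (hb : BoundaryBounds u₀ u₁ Θ D L K B) (hσ : 0 < σ) (y : Fin n → ℝ)
    (p : Fin (n + 1) → ℝ) (hp : p 0 ∈ Set.Icc 0 σ) :
    |v (p + Fin.cons 0 y) - v p| ≤ 2 * L * ‖y‖ := by
  set w : Fin (n + 1) → ℝ := Fin.cons 0 y with hw
  have hw0 : (p + w) 0 = p 0 := by simp [hw]
  have h1 := hv.horizontal_sub_le hb hσ y p hp
  have h2 := hv.horizontal_sub_le hb hσ (-y) (p + w) (by rwa [hw0])
  have hneg : (Fin.cons 0 (-y) : Fin (n + 1) → ℝ) = -w := by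
    ext i
    refine Fin.cases ?_ (fun j => ?_) i <;> simp [hw]
  rw [hneg, add_neg_cancel_right, norm_neg] at h2
  have ht0 : 0 ≤ p 0 / σ := div_nonneg hp.1 hσ.le
  have ht1 : 0 ≤ 1 - p 0 / σ := sub_nonneg.mpr ((div_le_one hσ).mpr hp.2)
  have h3 : |interpolation u₀ u₁ σ (p + w) - interpolation u₀ u₁ σ p| ≤ L * ‖y‖ := by
    have ht : Fin.tail (p + w) = Fin.tail p + y := rfl
    have e : interpolation u₀ u₁ σ (p + w) - interpolation u₀ u₁ σ p
        = (1 - p 0 / σ) * (u₀ (Fin.tail p + y) - u₀ (Fin.tail p))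
          + (p 0 / σ) * (u₁ (Fin.tail p + y) - u₁ (Fin.tail p)) := by
      rw [interpolation, interpolation, hw0, ht]
      ring
    rw [e]
    refine (abs_add_le _ _).trans ?_
    rw [abs_mul, abs_mul, abs_of_nonneg ht0, abs_of_nonneg ht1]
    nlinarith [mul_le_mul_of_nonneg_left (hb.lip₀ (Fin.tail p) y) ht1,
      mul_le_mul_of_nonneg_left (hb.lip₁ (Fin.tail p) y) ht0]
  rw [abs_le] at h3 ⊢
  constructor <;> linarith

theorem abs_vertical_sub_le (hv : IsDirichletSolution u₀ u₁ Θ σ v)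
    (hb : BoundaryBounds u₀ u₁ Θ D L K B) (hn : 1 ≤ n)
    (hΘ : ((n : ℝ) - 1) * Real.pi / 2 ≤ Θ) (hσ : 0 < σ) (hσ1 : σ ≤ 1) {r : ℝ} (hr : 0 ≤ r)
    (p : Fin (n + 1) → ℝ) (hp : 0 ≤ p 0) (hpr : p 0 + r ≤ σ) :
    |v (p + r • Pi.single 0 1) - v p| ≤ (B + 4 * D + K) / σ * r := by
  set w : Fin (n + 1) → ℝ := r • Pi.single 0 1 with hw
  have hw0 : ∀ q : Fin (n + 1) → ℝ, (q + w) 0 = q 0 + r := fun q => by simp [hw]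
  have hwt : ∀ q : Fin (n + 1) → ℝ, Fin.tail (q + w) = Fin.tail q := fun q => by
    ext j
    simp [hw, Fin.tail]
  have hu := hv.contDiff_add hb
  have hu' : ContDiff ℝ 2 fun q => interpolation u₀ u₁ σ (q + w) + v (q + w) :=
    hu.comp (contDiff_id.add contDiff_const)
  have hrσ : 0 ≤ r / σ := div_nonneg hr hσ.le
  have hI : ∀ q : Fin (n + 1) → ℝ, interpolation u₀ u₁ σ (q + w) - interpolation u₀ u₁ σ q
      = r / σ * (u₁ (Fin.tail q) - u₀ (Fin.tail q)) := fun q => by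
    rw [interpolation, interpolation, hw0, hwt]
    ring
  have hIle : ∀ q : Fin (n + 1) → ℝ,
      |interpolation u₀ u₁ σ (q + w) - interpolation u₀ u₁ σ q| ≤ D * (r / σ) := fun q => by
    rw [hI, abs_mul, abs_of_nonneg hrσ, mul_comm]
    exact mul_le_mul_of_nonneg_right (hb.diff_le _) hrσ
  have hper : ∀ q k, interpolation u₀ u₁ σ (q + latticeShift k + w) + v (q + latticeShift k + w)
        - (interpolation u₀ u₁ σ (q + latticeShift k) + v (q + latticeShift k))
      = interpolation u₀ u₁ σ (q + w) + v (q + w) - (interpolation u₀ u₁ σ q + v q) := by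
    intro q k
    obtain ⟨c, hc⟩ := hv.add_latticeShift hb k
    have h := (hc (q + w)).1
    rw [add_right_comm] at h
    linarith [(hc q).1]
  have hphase : ∀ q : Fin (n + 1) → ℝ, q 0 ∈ Set.Ioo 0 (σ - r) →
      lagPhase (hess (fun q => interpolation u₀ u₁ σ (q + w) + v (q + w)) q)
        = lagPhase (hess (fun q => interpolation u₀ u₁ σ q + v q) q) := by
    intro q hq
    rw [hess_comp_add_right (fun q => interpolation u₀ u₁ σ q + v q),
      hv.phase q ⟨hq.1.le, by linarith [hq.2]⟩,
      hv.phase (q + w) (by rw [hw0]; constructor <;> linarith [hq.1, hq.2])]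
  have hbot : ∀ q : Fin (n + 1) → ℝ, q 0 = 0 →
      |interpolation u₀ u₁ σ (q + w) + v (q + w) - (interpolation u₀ u₁ σ q + v q)|
        ≤ (B + 3 * D + K) * (r / σ) := by
    intro q hq
    have h := (hv.abs_le_bot_top hb hn hΘ hσ hσ1 (q + w)
      (by rw [hw0, hq]; constructor <;> linarith)).1
    rw [hw0, hq, zero_add] at h
    have h' := hIle q
    rw [hv.bot q hq]
    rw [abs_le] at h h' ⊢
    constructor <;> linarith
  have htop : ∀ q : Fin (n + 1) → ℝ, q 0 = σ - r →
      |interpolation u₀ u₁ σ (q + w) + v (q + w) - (interpolation u₀ u₁ σ q + v q)|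
        ≤ (B + 3 * D + K) * (r / σ) := by
    intro q hq
    have h := (hv.abs_le_bot_top hb hn hΘ hσ hσ1 q (by rw [hq]; constructor <;> linarith)).2
    rw [hq, sub_div, div_self hσ.ne', sub_sub_cancel] at h
    have h' := hIle q
    rw [hv.top (q + w) (by rw [hw0, hq]; ring)]
    rw [abs_le] at h h' ⊢
    constructor <;> linarith
  have hp' : p 0 ∈ Set.Icc 0 (σ - r) := ⟨hp, by linarith⟩
  have h1 := sub_le_of_lagPhase_le hu' hu hper (fun q hq => (hphase q hq).ge)
    (fun q hq => (le_abs_self _).trans (hbot q hq))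
    (fun q hq => (le_abs_self _).trans (htop q hq)) p hp'
  have h2 := sub_le_of_lagPhase_le hu hu' (fun q k => by linarith [hper q k])
    (fun q hq => (hphase q hq).le)
    (fun q hq => (le_abs_self _).trans ((abs_sub_comm _ _).trans_le (hbot q hq)))
    (fun q hq => (le_abs_self _).trans ((abs_sub_comm _ _).trans_le (htop q hq))) p hp'
  have h3 := hIle p
  have h4 : (B + 4 * D + K) / σ * r = (B + 3 * D + K) * (r / σ) + D * (r / σ) := by ring
  rw [h4]
  rw [abs_le] at h3 ⊢
  constructor <;> linarith

theorem abs_fderiv_succ_le (hv : IsDirichletSolution u₀ u₁ Θ σ v)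
    (hb : BoundaryBounds u₀ u₁ Θ D L K B) (hσ : 0 < σ) (i : Fin n)
    (p : Fin (n + 1) → ℝ) (hp : p 0 ∈ Set.Icc 0 σ) :
    |fderiv ℝ v p (Pi.single i.succ 1)| ≤ 2 * L := by
  have hd := hasDerivAt_comp_line (hv.contDiff.differentiable (by norm_num)) p
    (Pi.single i.succ 1) 0
  rw [zero_smul, add_zero] at hd
  refine hd.le_of_lip' (by linarith [hb.L_nonneg]) (Filter.Eventually.of_forall fun r => ?_)
  have hr : r • (Pi.single i.succ 1 : Fin (n + 1) → ℝ) = Fin.cons 0 (r • Pi.single i 1) := by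
    ext j
    refine Fin.cases ?_ (fun j => ?_) j <;> simp [Pi.single_apply]
  have h := hv.abs_horizontal_sub_le hb hσ (r • Pi.single i 1) p hp
  rw [norm_smul, Pi.norm_single, norm_one, mul_one] at h
  simpa [hr] using h

theorem abs_fderiv_zero_le (hv : IsDirichletSolution u₀ u₁ Θ σ v)
    (hb : BoundaryBounds u₀ u₁ Θ D L K B) (hn : 1 ≤ n)
    (hΘ : ((n : ℝ) - 1) * Real.pi / 2 ≤ Θ) (hσ : 0 < σ) (hσ1 : σ ≤ 1) (x : Fin n → ℝ)
    {s : ℝ} (hs : s ∈ Set.Icc 0 σ) :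
    |fderiv ℝ v (Fin.cons s x) (Pi.single 0 1)| ≤ (B + 4 * D + K) / σ := by
  have hC : 0 ≤ (B + 4 * D + K) / σ := by
    refine div_nonneg ?_ hσ.le
    linarith [hb.B_nonneg, hb.K_nonneg, (abs_nonneg _).trans (hb.diff_le x)]
  have hcont : Continuous fun s : ℝ => |fderiv ℝ v (Fin.cons s x) (Pi.single 0 1)| := by
    have hcons : Continuous fun s : ℝ => (Fin.cons s x : Fin (n + 1) → ℝ) :=
      continuous_pi fun j => by refine Fin.cases ?_ (fun j => ?_) j <;> simp <;> fun_prop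
    exact (((hv.contDiff.continuous_fderiv (by norm_num)).comp hcons).clm_apply
      continuous_const).abs
  have hsub : Set.Ioo 0 σ ⊆
      {s : ℝ | |fderiv ℝ v (Fin.cons s x) (Pi.single 0 1)| ≤ (B + 4 * D + K) / σ} := by
    intro s hs
    have hd := hasDerivAt_comp_line (hv.contDiff.differentiable (by norm_num)) (Fin.cons s x)
      (Pi.single 0 1) 0
    rw [zero_smul, add_zero] at hd
    refine hd.le_of_lip' hC ?_
    filter_upwards [Ioo_mem_nhds (a := -s) (b := σ - s) (neg_lt_zero.mpr hs.1)
      (sub_pos.mpr hs.2)] with r hr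
    rw [zero_smul, add_zero, sub_zero, Real.norm_eq_abs, Real.norm_eq_abs]
    rcases le_total 0 r with h0 | h0
    · rw [abs_of_nonneg h0]
      exact hv.abs_vertical_sub_le hb hn hΘ hσ hσ1 h0 _ hs.1.le (by
        rw [Fin.cons_zero]
        linarith [hr.2])
    · have h := hv.abs_vertical_sub_le hb hn hΘ hσ hσ1 (neg_nonneg.mpr h0)
        (Fin.cons s x + r • Pi.single 0 1) (by simp; linarith [hr.1]) (by simp; linarith [hs.2])
      rw [add_assoc, ← add_smul, add_neg_cancel, zero_smul, add_zero, abs_sub_comm] at h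
      rwa [abs_of_nonpos h0]
  have hclosed := closure_minimal hsub (isClosed_le hcont continuous_const)
  rw [closure_Ioo hσ.ne] at hclosed
  exact hclosed hs

end IsDirichletSolution

end Dirichlet

/-- (Uniform `C¹` a priori estimate, independent of `τ`.) With
`u₀, u₁, Θ` as in the Dirichlet problem, there is a constant `C` (depending only on
`n, Θ, u₀, u₁`, not on `τ`) such that: for every `τ ∈ (0, 1]` and every smooth solution
`v^τ` of the Dirichlet problem
`∑ arctan λ_j(D²(ũ^τ + v^τ)) = Θ` on `[0, √τ] × 𝕋ⁿ` with zero boundary values, the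
rescaled function `v̂^τ(t, x) = v^τ(√τ·t, x)` satisfies
`sup (|v̂^τ| + |∂_t v̂^τ| + |∇ₓ v̂^τ|) ≤ C` on `[0, 1] × ℝⁿ`. -/
theorem stmt16 {n : ℕ} (hn : 1 ≤ n) (u₀ u₁ : (Fin n → ℝ) → ℝ)
    (hu₀ : ContDiff ℝ (⊤ : ℕ∞) u₀) (hu₁ : ContDiff ℝ (⊤ : ℕ∞) u₁)
    (hper₀ : ∀ (x : Fin n → ℝ) (k : Fin n → ℤ),
      fderiv ℝ u₀ (x + fun j => (k j : ℝ)) = fderiv ℝ u₀ x)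
    (hper₁ : ∀ (x : Fin n → ℝ) (k : Fin n → ℤ),
      fderiv ℝ u₁ (x + fun j => (k j : ℝ)) = fderiv ℝ u₁ x)
    (hdiff : ∀ (x : Fin n → ℝ) (k : Fin n → ℤ),
      u₁ (x + fun j => (k j : ℝ)) - u₀ (x + fun j => (k j : ℝ)) = u₁ x - u₀ x)
    (Θ : ℝ) (hΘ₁ : ((n : ℝ) - 1) * Real.pi / 2 ≤ Θ) (hΘ₂ : Θ < ((n : ℝ) + 1) * Real.pi / 2)
    (hphase₀ : ∀ x, Θ - Real.pi / 2 < lagPhase (hess u₀ x))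
    (hphase₁ : ∀ x, Θ - Real.pi / 2 < lagPhase (hess u₁ x)) :
    ∃ C : ℝ, ∀ τ ∈ Set.Ioc (0 : ℝ) 1, ∀ v : (Fin (n + 1) → ℝ) → ℝ,
      ContDiff ℝ (⊤ : ℕ∞) v →
      (∀ (s : ℝ) (x : Fin n → ℝ) (k : Fin n → ℤ),
        v (Fin.cons s (x + fun j => (k j : ℝ))) = v (Fin.cons s x)) →
      (∀ x : Fin n → ℝ, v (Fin.cons 0 x) = 0) →
      (∀ x : Fin n → ℝ, v (Fin.cons (Real.sqrt τ) x) = 0) →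
      (∀ s ∈ Set.Icc (0 : ℝ) (Real.sqrt τ), ∀ x : Fin n → ℝ,
        lagPhase (hess (fun p => (1 - p 0 / Real.sqrt τ) * u₀ (Fin.tail p)
            + (p 0 / Real.sqrt τ) * u₁ (Fin.tail p) + v p) (Fin.cons s x)) = Θ) →
      ∀ t ∈ Set.Icc (0 : ℝ) 1, ∀ x : Fin n → ℝ,
        |v (Fin.cons (Real.sqrt τ * t) x)|
          + |Real.sqrt τ * fderiv ℝ v (Fin.cons (Real.sqrt τ * t) x) (Pi.single 0 1)|
          + Real.sqrt (∑ i : Fin n,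
              (fderiv ℝ v (Fin.cons (Real.sqrt τ * t) x) (Pi.single i.succ 1)) ^ 2)
        ≤ C := by
  have hu₀' : ContDiff ℝ 2 u₀ := hu₀.of_le (WithTop.coe_le_coe.mpr le_top)
  have hu₁' : ContDiff ℝ 2 u₁ := hu₁.of_le (WithTop.coe_le_coe.mpr le_top)
  obtain ⟨D, L, K, B, hb⟩ :=
    exists_boundaryBounds hu₀' hu₁' hper₀ hper₁ hdiff hphase₀ hphase₁
  refine ⟨(B + 2 * D + K) + (B + 4 * D + K) + Real.sqrt (∑ _i : Fin n, (2 * L) ^ 2), ?_⟩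
  intro τ hτ v hv hvper hv0 hv1 hphase t ht x
  have hσ : 0 < Real.sqrt τ := Real.sqrt_pos.mpr hτ.1
  have hσ1 : Real.sqrt τ ≤ 1 := Real.sqrt_le_one.mpr hτ.2
  have hcons : ∀ p : Fin (n + 1) → ℝ, p = Fin.cons (p 0) (Fin.tail p) :=
    fun p => (Fin.cons_self_tail p).symm
  have hsol : IsDirichletSolution u₀ u₁ Θ (Real.sqrt τ) v := by
    refine ⟨hv.of_le (WithTop.coe_le_coe.mpr le_top), fun p k => ?_, fun p hp => ?_, fun p hp => ?_,
      fun p hp => ?_⟩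
    · rw [hcons (p + latticeShift k), tail_add_latticeShift, hvper, Pi.add_apply,
        latticeShift_zero, add_zero, ← hcons]
    · rw [hcons p, hp, hv0]
    · rw [hcons p, hp, hv1]
    · have h := hphase (p 0) hp (Fin.tail p)
      rw [← hcons] at h
      exact h
  have hs : Real.sqrt τ * t ∈ Set.Icc 0 (Real.sqrt τ) :=
    ⟨mul_nonneg hσ.le ht.1, mul_le_of_le_one_right hσ.le ht.2⟩
  refine add_le_add (add_le_add ?_ ?_) ?_
  · have h := (hsol.abs_le_bot_top hb hn hΘ₁ hσ hσ1 (Fin.cons (Real.sqrt τ * t) x) hs).1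
    rw [Fin.cons_zero, mul_div_cancel_left₀ _ hσ.ne'] at h
    refine h.trans (mul_le_of_le_one_right ?_ ht.2)
    linarith [hb.B_nonneg, hb.K_nonneg, (abs_nonneg _).trans (hb.diff_le x)]
  · rw [abs_mul, abs_of_pos hσ, mul_comm, ← le_div_iff₀ hσ]
    exact hsol.abs_fderiv_zero_le hb hn hΘ₁ hσ hσ1 x hs
  · refine Real.sqrt_le_sqrt (Finset.sum_le_sum fun i _ => ?_)
    exact sq_le_sq' (abs_le.mp (hsol.abs_fderiv_succ_le hb hσ i _ hs)).1
      (abs_le.mp (hsol.abs_fderiv_succ_le hb hσ i _ hs)).2
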